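/- arXiv:2111.03273 — 2 statements merged into one kernel-verified Lean document; each statement's English description precedes it below -/
import Mathlib

section
/- Let d ≥ 1, k ≥ 1, let T be a finite index set, and for each t ∈ T let A_t and B_t be positive semidefinite complex matrices indexed by (Fin k → Fin d). Let M = Σ_{t∈T} A_t ⊗ B_t (Kronecker product, a matrix indexed by (Fin k → Fin d) × (Fin k → Fin d)), and assume I − M is positive semidefinite. If ∬ Tr(M · (|φ⟩⟨φ|^{⊗k} ⊗ |ψ⟩⟨ψ|^{⊗k})) dμ_d(φ) dμ_d(ψ) − ∫ Tr(M · (|φ⟩⟨φ|^{⊗k} ⊗ |φ⟩⟨φ|^{⊗k})) dμ_d(φ) ≥ 1/3, then e^{k²/d} − 1 ≥ 1/3 (equivalently, k² ≥ d·log(4/3)). This establishes that any separable measurement, and in particular any LOCC protocol, solving decisional inner product estimation requires k = Ω(√d) copies. -/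
open MeasureTheory
open scoped ComplexOrder

noncomputable section

/-- `ℂ^d`. -/
abbrev Cvec (d : ℕ) : Type := EuclideanSpace ℂ (Fin d)

instance (d : ℕ) : MeasurableSpace (Cvec d) := borel _
instance (d : ℕ) : BorelSpace (Cvec d) := ⟨rfl⟩

/-- The unit sphere of `ℂ^d`. -/
abbrev USphere (d : ℕ) := Metric.sphere (0 : Cvec d) 1

/-- The action of a unitary (linear isometric equivalence) on the unit sphere. -/
def sphereRot (d : ℕ) (e : Cvec d ≃ₗᵢ[ℂ] Cvec d) (x : USphere d) : USphere d :=
  ⟨e x, by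
    have hx : ‖(x : Cvec d)‖ = 1 := mem_sphere_zero_iff_norm.mp x.2
    simp [mem_sphere_zero_iff_norm, e.norm_map, hx]⟩

/-- `μ` is the uniform (rotation-invariant) probability measure on the unit sphere of `ℂ^d`. -/
def IsUniformOnSphere (d : ℕ) (μ : Measure (USphere d)) : Prop :=
  IsProbabilityMeasure μ ∧
    ∀ e : Cvec d ≃ₗᵢ[ℂ] Cvec d, μ.map (sphereRot d e) = μ

/-- `|φ⟩⟨φ|^{⊗k}`, as a matrix indexed by `Fin k → Fin d`. -/
def ketbraPow (d k : ℕ) (φ : Cvec d) : Matrix (Fin k → Fin d) (Fin k → Fin d) ℂ :=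
  fun i j => ∏ a : Fin k, φ (i a) * star (φ (j a))

open Finset in
theorem factorial_add_eq_sum_contingency {N a b a' b' : ℕ} (ha' : a' < N)
    (hb' : b' < N) :
    (if a + b = a' + b' then ((a + b).factorial : ℂ) else 0) =
      ∑ x ∈ range N, ∑ w ∈ range N, ∑ y ∈ range N, ∑ z ∈ range N,
        if x + y = a ∧ z + w = b ∧ x + z = a' ∧ y + w = b' then
          ((a.factorial * b'.factorial * (b.factorial * a'.factorial) : ℕ) : ℂ) /
            ((x.factorial * w.factorial * (y.factorial * z.factorial) : ℕ) : ℂ) else 0 := by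
  split_ifs with h
  · have hc := Nat.add_choose_eq a b a'
    have h1 : (a + b).factorial =
        ∑ x ∈ range N, ∑ z ∈ range N, if x + z = a' then
          a.choose x * b.choose z * (a'.factorial * b'.factorial) else 0 := by
      rw [← Nat.choose_mul_factorial_mul_factorial (show a' ≤ a + b by omega), hc,
        show a + b - a' = b' by omega, ← Finset.sum_product', ← Finset.sum_filter, mul_assoc,
        Finset.sum_mul]
      refine (Finset.sum_subset_zero_on_sdiff ?_ ?_ ?_)
      · intro p hp
        simp only [HasAntidiagonal.mem_antidiagonal] at hp
        simp only [mem_filter, mem_product, mem_range]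
        omega
      · intro p hp
        simp only [mem_sdiff, mem_filter, mem_product,
          HasAntidiagonal.mem_antidiagonal] at hp
        tauto
      · intro p _; rfl
    rw [h1]
    push_cast
    refine Finset.sum_congr rfl fun x hx => ?_
    have h2 : ∀ z ∈ range N, (∑ w ∈ range N, ∑ y ∈ range N,
        if x + y = a ∧ z + w = b ∧ x + z = a' ∧ y + w = b' then
          ((a.factorial : ℂ) * b'.factorial * (b.factorial * a'.factorial)) /
            (x.factorial * w.factorial * (y.factorial * z.factorial)) else 0) =
        if x + z = a' then
          (a.choose x : ℂ) * b.choose z * (a'.factorial * b'.factorial) else 0 := by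
      intro z _
      split_ifs with hz
      · by_cases hxa : x ≤ a
        · by_cases hzb : z ≤ b
          · rw [Finset.sum_eq_single (b - z), Finset.sum_eq_single (a - x)]
            · rw [if_pos (by omega), Nat.cast_choose ℂ hxa, Nat.cast_choose ℂ hzb]
              have := fun n : ℕ => (Nat.cast_ne_zero (R := ℂ)).2 n.factorial_ne_zero
              field_simp [this]
            · intro y _ hy
              rw [if_neg (by omega)]
            · intro hy; simp at hy; omega
            · intro w _ hw
              exact Finset.sum_eq_zero fun y _ => if_neg (by omega)
            · intro hy; simp at hy; omega
          · rw [Nat.choose_eq_zero_of_lt (not_le.1 hzb)]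
            simp only [Nat.cast_zero, mul_zero, zero_mul]
            exact Finset.sum_eq_zero fun w _ => Finset.sum_eq_zero fun y _ => if_neg (by omega)
        · rw [Nat.choose_eq_zero_of_lt (not_le.1 hxa)]
          simp only [Nat.cast_zero, zero_mul]
          exact Finset.sum_eq_zero fun w _ => Finset.sum_eq_zero fun y _ => if_neg (by omega)
      · exact Finset.sum_eq_zero fun w _ => Finset.sum_eq_zero fun y _ => if_neg (by tauto)
    rw [← Finset.sum_congr rfl h2, Finset.sum_comm]
    refine Finset.sum_congr rfl fun w _ => ?_
    rw [Finset.sum_comm]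
  · symm
    refine Finset.sum_eq_zero fun x _ => Finset.sum_eq_zero fun w _ => Finset.sum_eq_zero
      fun y _ => Finset.sum_eq_zero fun z _ => if_neg (by omega)

/-- The factorial `∏ l, (α l)!` of a multi-index. -/
def multiFactorial {ι : Type*} [Fintype ι] (α : ι → ℕ) : ℕ := ∏ l, (α l).factorial

/-- The multi-indices all of whose entries are smaller than `N`. -/
def multiBox (ι : Type*) [Fintype ι] [DecidableEq ι] (N : ℕ) : Finset (ι → ℕ) :=
  Fintype.piFinset fun _ => Finset.range N

theorem mem_multiBox {ι : Type*} [Fintype ι] [DecidableEq ι] {N : ℕ} {α : ι → ℕ} :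
    α ∈ multiBox ι N ↔ ∀ l, α l < N := by simp [multiBox]

theorem multiFactorial_add_eq_sum_contingency {ι : Type*} [Fintype ι] [DecidableEq ι] {N : ℕ}
    {a b a' b' : ι → ℕ} (ha' : a' ∈ multiBox ι N) (hb' : b' ∈ multiBox ι N) :
    (if a + b = a' + b' then (multiFactorial (a + b) : ℂ) else 0) =
      ∑ x ∈ multiBox ι N, ∑ w ∈ multiBox ι N, ∑ y ∈ multiBox ι N, ∑ z ∈ multiBox ι N,
        if x + y = a ∧ z + w = b ∧ x + z = a' ∧ y + w = b' then
          ((multiFactorial a * multiFactorial b' *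
            (multiFactorial b * multiFactorial a') : ℕ) : ℂ) /
            ((multiFactorial x * multiFactorial w *
              (multiFactorial y * multiFactorial z) : ℕ) : ℂ) else 0 := by
  rw [mem_multiBox] at ha' hb'
  have h := Finset.prod_congr (M := ℂ) (rfl : (Finset.univ : Finset ι) = _) fun l _ =>
    factorial_add_eq_sum_contingency (a := a l) (b := b l) (ha' l) (hb' l)
  simp_rw [Finset.prod_univ_sum, Finset.prod_ite_zero] at h
  convert h using 1
  · simp [funext_iff, multiFactorial]
  · simp only [multiBox]
    refine Finset.sum_congr rfl fun x _ => Finset.sum_congr rfl fun w _ => Finset.sum_congr rfl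
      fun y _ => Finset.sum_congr rfl fun z _ => ?_
    simp only [funext_iff, multiFactorial, Finset.mem_univ, true_implies, ← forall_and,
      Pi.add_apply, Nat.cast_mul, Nat.cast_prod, Finset.prod_mul_distrib, Finset.prod_div_distrib]

/-- The multi-indices of total degree `n`. -/
def multiDeg (ι : Type*) [Fintype ι] [DecidableEq ι] (n : ℕ) : Finset (ι → ℕ) :=
  Finset.piAntidiag Finset.univ n

theorem mem_multiDeg {ι : Type*} [Fintype ι] [DecidableEq ι] {n : ℕ} {α : ι → ℕ} :
    α ∈ multiDeg ι n ↔ ∑ l, α l = n := by simp [multiDeg]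

theorem multiDeg_subset_multiBox {ι : Type*} [Fintype ι] [DecidableEq ι] {n N : ℕ}
    (h : n < N) : multiDeg ι n ⊆ multiBox ι N := by
  intro α hα
  rw [mem_multiDeg] at hα
  rw [mem_multiBox]
  intro l
  have := Finset.single_le_sum (f := α) (fun _ _ => Nat.zero_le _) (Finset.mem_univ l)
  omega

/-- The coefficients of the product of two homogeneous polynomials. -/
def coeffMul {ι : Type*} [Fintype ι] [DecidableEq ι] (m n : ℕ) (p q : (ι → ℕ) → ℂ)
    (γ : ι → ℕ) : ℂ :=
  ∑ x ∈ (multiDeg ι m ×ˢ multiDeg ι n).filter (fun x => x.1 + x.2 = γ), p x.1 * q x.2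

theorem sum_normSq_coeffMul {ι : Type*} [Fintype ι] [DecidableEq ι] (m n : ℕ)
    (p q : (ι → ℕ) → ℂ) :
    ((∑ γ ∈ multiDeg ι (m + n), multiFactorial γ * ‖coeffMul m n p q γ‖ ^ 2 : ℝ) : ℂ) =
      ∑ x ∈ multiDeg ι m ×ˢ multiDeg ι n, ∑ y ∈ multiDeg ι m ×ˢ multiDeg ι n,
        (if x.1 + x.2 = y.1 + y.2 then (multiFactorial (x.1 + x.2) : ℂ) else 0) *
          (p x.1 * q x.2 * star (p y.1 * q y.2)) := by
  have hmaps : ∀ x ∈ multiDeg ι m ×ˢ multiDeg ι n, x.1 + x.2 ∈ multiDeg ι (m + n) := by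
    intro x hx
    simp only [Finset.mem_product, mem_multiDeg] at hx ⊢
    simp [Finset.sum_add_distrib, hx]
  rw [← Finset.sum_fiberwise_of_maps_to hmaps]
  push_cast
  refine Finset.sum_congr rfl fun γ _ => ?_
  rw [← Complex.mul_conj', coeffMul, map_sum, Finset.sum_mul_sum, Finset.mul_sum]
  refine Finset.sum_congr rfl fun x hx => ?_
  rw [Finset.sum_filter, Finset.mul_sum]
  refine Finset.sum_congr rfl fun y _ => ?_
  rw [(Finset.mem_filter.1 hx).2]
  by_cases h : y.1 + y.2 = γ
  · simp [h]
  · simp [h, Ne.symm h]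

/-- Contraction of the coefficients of `p` and `q` along a common factor. -/
def coeffContract {ι : Type*} [Fintype ι] [DecidableEq ι] (m n N : ℕ) (p q : (ι → ℕ) → ℂ)
    (x w : ι → ℕ) : ℂ :=
  ∑ y ∈ multiBox ι N, if x + y ∈ multiDeg ι m ∧ y + w ∈ multiDeg ι n then
    (multiFactorial (x + y) * multiFactorial (y + w) : ℂ) / multiFactorial y *
      (p (x + y) * star (q (y + w))) else 0

theorem sum_normSq_coeffMul_eq_sum_normSq_coeffContract {ι : Type*} [Fintype ι] [DecidableEq ι]
    {m n N : ℕ} (hm : m < N) (hn : n < N) (p q : (ι → ℕ) → ℂ) :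
    ∑ γ ∈ multiDeg ι (m + n), multiFactorial γ * ‖coeffMul m n p q γ‖ ^ 2 =
      ∑ x ∈ multiBox ι N, ∑ w ∈ multiBox ι N,
        ‖coeffContract m n N p q x w‖ ^ 2 / (multiFactorial x * multiFactorial w) := by
  apply Complex.ofReal_injective
  rw [sum_normSq_coeffMul]
  have h : ∀ x ∈ multiDeg ι m ×ˢ multiDeg ι n, ∀ y ∈ multiDeg ι m ×ˢ multiDeg ι n,
      (if x.1 + x.2 = y.1 + y.2 then (multiFactorial (x.1 + x.2) : ℂ) else 0) *
          (p x.1 * q x.2 * star (p y.1 * q y.2)) =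
      ∑ r ∈ multiBox ι N, ∑ w ∈ multiBox ι N, ∑ s ∈ multiBox ι N, ∑ t ∈ multiBox ι N,
        if r + s = x.1 ∧ t + w = x.2 ∧ r + t = y.1 ∧ s + w = y.2 then
          ((multiFactorial (r + s) * multiFactorial (s + w) *
            (multiFactorial (t + w) * multiFactorial (r + t)) : ℕ) : ℂ) /
            ((multiFactorial r * multiFactorial w *
              (multiFactorial s * multiFactorial t) : ℕ) : ℂ) *
          (p (r + s) * q (t + w) * star (p (r + t) * q (s + w))) else 0 := by
    intro x _ y hy
    rw [Finset.mem_product] at hy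
    rw [multiFactorial_add_eq_sum_contingency (multiDeg_subset_multiBox hm hy.1)
      (multiDeg_subset_multiBox hn hy.2)]
    simp only [Finset.sum_mul]
    refine Finset.sum_congr rfl fun r _ => Finset.sum_congr rfl fun w _ => Finset.sum_congr rfl
      fun s _ => Finset.sum_congr rfl fun t _ => ?_
    split_ifs with hc
    · obtain ⟨h1, h2, h3, h4⟩ := hc
      rw [h1, h2, h3, h4]
    · exact zero_mul _
  rw [Finset.sum_congr rfl fun x hx => Finset.sum_congr rfl fun y hy => h x hx y hy]
  push_cast
  have hcomm : ∀ (P : Finset (((ι → ℕ) × (ι → ℕ)) × ((ι → ℕ) × (ι → ℕ))))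
      (B : Finset (ι → ℕ)) (f : _ → (ι → ℕ) → (ι → ℕ) → (ι → ℕ) → (ι → ℕ) → ℂ),
      ∑ x ∈ P, ∑ r ∈ B, ∑ w ∈ B, ∑ s ∈ B, ∑ t ∈ B, f x r w s t =
      ∑ r ∈ B, ∑ w ∈ B, ∑ s ∈ B, ∑ t ∈ B, ∑ x ∈ P, f x r w s t := by
    intro P B f
    rw [Finset.sum_comm]
    refine Finset.sum_congr rfl fun r _ => ?_
    rw [Finset.sum_comm]
    refine Finset.sum_congr rfl fun w _ => ?_
    rw [Finset.sum_comm]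
    refine Finset.sum_congr rfl fun s _ => ?_
    rw [Finset.sum_comm]
  rw [← Finset.sum_product', hcomm]
  refine Finset.sum_congr rfl fun r _ => Finset.sum_congr rfl fun w _ => ?_
  rw [← Complex.mul_conj', coeffContract, map_sum, Finset.sum_mul_sum, Finset.sum_div]
  refine Finset.sum_congr rfl fun s _ => ?_
  rw [Finset.sum_div]
  refine Finset.sum_congr rfl fun t _ => ?_
  have hpair : ∀ x : ((ι → ℕ) × (ι → ℕ)) × ((ι → ℕ) × (ι → ℕ)),
      (r + s = x.1.1 ∧ t + w = x.1.2 ∧ r + t = x.2.1 ∧ s + w = x.2.2) ↔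
        ((r + s, t + w), (r + t, s + w)) = x := by
    intro x
    simp only [Prod.ext_iff, and_assoc]
  simp only [hpair, Finset.sum_ite_eq, Finset.mem_product]
  simp only [apply_ite (starRingEnd ℂ), map_zero, ite_zero_mul_ite_zero, ite_div,
    zero_div]
  refine if_congr (by tauto) ?_ rfl
  simp only [map_mul, map_div₀, Complex.conj_natCast, Complex.star_def, Complex.conj_conj]
  ring

/-- Bombieri's inequality for products of homogeneous polynomials. -/
theorem bombieri_inequality {ι : Type*} [Fintype ι] [DecidableEq ι] (m n : ℕ)
    (p q : (ι → ℕ) → ℂ) :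
    (∑ α ∈ multiDeg ι m, multiFactorial α * ‖p α‖ ^ 2) *
      (∑ β ∈ multiDeg ι n, multiFactorial β * ‖q β‖ ^ 2) ≤
    ∑ γ ∈ multiDeg ι (m + n), (multiFactorial γ : ℝ) * ‖coeffMul m n p q γ‖ ^ 2 := by
  have hm : m < m + n + 1 := by omega
  have hn : n < m + n + 1 := by omega
  rw [sum_normSq_coeffMul_eq_sum_normSq_coeffContract hm hn]
  refine le_trans ?_ (Finset.sum_le_sum_of_subset_of_nonneg (multiDeg_subset_multiBox hm)
    fun x _ _ => Finset.sum_nonneg fun w _ => by positivity)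
  rw [Finset.sum_mul_sum]
  refine Finset.sum_le_sum fun x hx => ?_
  refine le_trans (le_of_eq ?_) (Finset.sum_le_sum_of_subset_of_nonneg
    (multiDeg_subset_multiBox hn) fun w _ _ => by positivity)
  refine Finset.sum_congr rfl fun w hw => ?_
  have hS : coeffContract m n (m + n + 1) p q x w =
      multiFactorial x * multiFactorial w * (p x * star (q w)) := by
    rw [coeffContract, Finset.sum_eq_single 0]
    · simp [hx, hw, multiFactorial]
    · intro y _ hy
      refine if_neg fun h => hy ?_
      have h1 := mem_multiDeg.1 h.1
      have h2 := mem_multiDeg.1 hx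
      simp only [Pi.add_apply, Finset.sum_add_distrib, h2] at h1
      have h3 : ∑ l, y l = 0 := by omega
      ext l
      simpa using Finset.sum_eq_zero_iff.1 h3 l (Finset.mem_univ l)
    · intro h
      exact absurd (mem_multiBox.2 fun l => by simp) h
  have hx0 : (multiFactorial x : ℝ) ≠ 0 := by
    exact_mod_cast Finset.prod_ne_zero_iff.2 fun l _ => (x l).factorial_ne_zero
  have hw0 : (multiFactorial w : ℝ) ≠ 0 := by
    exact_mod_cast Finset.prod_ne_zero_iff.2 fun l _ => (w l).factorial_ne_zero
  rw [hS]
  simp only [norm_mul, Complex.norm_natCast, norm_star]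
  field_simp

/-- The monomial `∏ l, φ l ^ α l`. -/
def sphereMonomial {d : ℕ} (φ : Cvec d) (α : Fin d → ℕ) : ℂ := ∏ l, φ l ^ α l

@[fun_prop]
theorem continuous_sphereMonomial {d : ℕ} (α : Fin d → ℕ) :
    Continuous fun φ : Cvec d => sphereMonomial φ α := by
  unfold sphereMonomial
  fun_prop

theorem integrable_of_continuous_on_sphere {d : ℕ} {μ : Measure (USphere d)}
    [IsFiniteMeasure μ] {E : Type*} [NormedAddCommGroup E] {f : USphere d → E}
    (hf : Continuous f) : Integrable f μ :=
  hf.integrable_of_hasCompactSupport (HasCompactSupport.of_compactSpace f)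

theorem IsUniformOnSphere.integral_comp {d : ℕ} {μ : Measure (USphere d)}
    (hμ : IsUniformOnSphere d μ) (e : Cvec d ≃ₗᵢ[ℂ] Cvec d) {f : Cvec d → ℂ}
    (hf : Continuous f) : ∫ φ : USphere d, f (e φ) ∂μ = ∫ φ : USphere d, f φ ∂μ := by
  have he : Continuous (sphereRot d e) :=
    Continuous.subtype_mk (e.continuous.comp continuous_subtype_val) _
  conv_rhs => rw [← hμ.2 e]
  exact (integral_map he.measurable.aemeasurable
    (hf.comp continuous_subtype_val).aestronglyMeasurable).symm

/-- A norm-preserving linear endomorphism of `ℂ^d` as a linear isometric equivalence. -/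
def isometryOfNormMap {d : ℕ} (f : Cvec d →ₗ[ℂ] Cvec d) (hf : ∀ φ, ‖f φ‖ = ‖φ‖) :
    Cvec d ≃ₗᵢ[ℂ] Cvec d :=
  LinearIsometry.toLinearIsometryEquiv ⟨f, hf⟩ rfl

@[simp]
theorem isometryOfNormMap_apply {d : ℕ} (f : Cvec d →ₗ[ℂ] Cvec d) (hf : ∀ φ, ‖f φ‖ = ‖φ‖)
    (φ : Cvec d) : isometryOfNormMap f hf φ = f φ := rfl

/-- The diagonal unitary with phases `c l`. -/
def phaseIsometry {d : ℕ} (c : Fin d → ℂ) (hc : ∀ l, ‖c l‖ = 1) : Cvec d ≃ₗᵢ[ℂ] Cvec d :=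
  isometryOfNormMap
    { toFun := fun φ => WithLp.toLp 2 fun l => c l * φ l
      map_add' := fun φ ψ => by ext l; simp [mul_add]
      map_smul' := fun a φ => by ext l; simp; ring }
    (fun φ => by simp [EuclideanSpace.norm_eq, hc])

@[simp]
theorem phaseIsometry_apply {d : ℕ} (c : Fin d → ℂ) (hc : ∀ l, ‖c l‖ = 1) (φ : Cvec d)
    (l : Fin d) : phaseIsometry c hc φ l = c l * φ l := rfl

theorem IsUniformOnSphere.integral_monomial_mul_star_of_ne {d : ℕ} {μ : Measure (USphere d)}
    (hμ : IsUniformOnSphere d μ) {α β : Fin d → ℕ} (h : α ≠ β) :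
    ∫ φ : USphere d, sphereMonomial (φ : Cvec d) α * star (sphereMonomial (φ : Cvec d) β) ∂μ
      = 0 := by
  obtain ⟨i, hi⟩ := Function.ne_iff.1 h
  have hi' : (α i : ℂ) - β i ≠ 0 := sub_ne_zero.2 (by exact_mod_cast hi)
  set θ : ℝ := Real.pi / ((α i : ℝ) - β i) with hθ
  have hc : ∀ l, ‖Function.update (1 : Fin d → ℂ) i (Complex.exp (θ * Complex.I)) l‖ = 1 := by
    intro l
    by_cases hl : l = i
    · subst hl
      simp [Complex.norm_exp_ofReal_mul_I θ]
    · simp [hl]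
  have hexp : Complex.exp (θ * Complex.I) ^ α i * star (Complex.exp (θ * Complex.I) ^ β i)
      = -1 := by
    rw [star_pow, Complex.star_def, ← Complex.exp_conj, ← Complex.exp_nat_mul,
      ← Complex.exp_nat_mul, ← Complex.exp_add, ← Complex.exp_pi_mul_I]
    congr 1
    simp only [map_mul, Complex.conj_ofReal, Complex.conj_I, hθ]
    push_cast
    field_simp
    ring
  have hmon : ∀ (φ : Cvec d) (γ : Fin d → ℕ), sphereMonomial (phaseIsometry _ hc φ) γ =
      Complex.exp (θ * Complex.I) ^ γ i * sphereMonomial φ γ := by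
    intro φ γ
    simp only [sphereMonomial, phaseIsometry_apply, mul_pow, Finset.prod_mul_distrib]
    congr 1
    rw [Finset.prod_eq_single i]
    · simp
    · intro l _ hl
      simp [hl]
    · simp
  have key := hμ.integral_comp (phaseIsometry _ hc)
    (f := fun φ => sphereMonomial φ α * star (sphereMonomial φ β)) (by fun_prop)
  have hneg : ∀ φ : Cvec d, sphereMonomial (phaseIsometry _ hc φ) α *
      star (sphereMonomial (phaseIsometry _ hc φ) β) =
      -(sphereMonomial φ α * star (sphereMonomial φ β)) := by
    intro φ
    rw [hmon, hmon, star_mul']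
    linear_combination (sphereMonomial φ α * star (sphereMonomial φ β)) * hexp
  simp only [hneg, integral_neg] at key
  exact self_eq_neg.1 key.symm

theorem IsUniformOnSphere.integral_deriv_eq_zero {d : ℕ} {μ : Measure (USphere d)}
    (hμ : IsUniformOnSphere d μ) (e : ℝ → Cvec d ≃ₗᵢ[ℂ] Cvec d) {f f' : Cvec d → ℂ}
    (hf : Continuous f) (hf' : Continuous f')
    (hderiv : ∀ (φ : Cvec d) (θ : ℝ), HasDerivAt (fun t => f (e t φ)) (f' (e θ φ)) θ) :
    ∫ φ : USphere d, f' φ ∂μ = 0 := by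
  have := hμ.1
  obtain ⟨C, hC⟩ := (isCompact_sphere (0 : Cvec d) 1).exists_bound_of_continuousOn
    hf'.continuousOn
  have hcont : ∀ (g : Cvec d → ℂ), Continuous g → ∀ θ,
      Continuous fun φ : USphere d => g (e θ φ) := fun g hg θ =>
    hg.comp ((e θ).continuous.comp continuous_subtype_val)
  have h := (hasDerivAt_integral_of_dominated_loc_of_deriv_le (μ := μ) (𝕜 := ℝ) (x₀ := 0)
    (s := Set.univ) (F := fun θ (φ : USphere d) => f (e θ φ))
    (F' := fun θ (φ : USphere d) => f' (e θ φ)) (bound := fun _ => C) Filter.univ_mem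
    (Filter.Eventually.of_forall fun θ => (hcont f hf θ).aestronglyMeasurable)
    (integrable_of_continuous_on_sphere (hcont f hf 0))
    (hcont f' hf' 0).aestronglyMeasurable
    (Filter.Eventually.of_forall fun φ θ _ => hC _ (sphereRot d (e θ) φ).2)
    (integrable_const C)
    (Filter.Eventually.of_forall fun φ θ _ => hderiv φ θ)).2
  simp only [hμ.integral_comp _ hf, hμ.integral_comp _ hf'] at h
  exact h.unique (hasDerivAt_const _ _)

/-- The rotation by the angle `θ` in the coordinates `i` and `j`. -/
def planeRotation {d : ℕ} {i j : Fin d} (hij : i ≠ j) (θ : ℝ) : Cvec d ≃ₗᵢ[ℂ] Cvec d :=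
  isometryOfNormMap
    { toFun := fun φ => WithLp.toLp 2 <| Function.update (Function.update φ i
        (Real.cos θ * φ i + Real.sin θ * φ j)) j (-Real.sin θ * φ i + Real.cos θ * φ j)
      map_add' := fun φ ψ => by
        ext l
        by_cases hj : l = j
        · subst hj; simp; ring
        by_cases hi : l = i
        · subst hi; simp [hij]; ring
        simp [hj, hi]
      map_smul' := fun a φ => by
        ext l
        by_cases hj : l = j
        · subst hj; simp; ring
        by_cases hi : l = i
        · subst hi; simp [hij]; ring
        simp [hj, hi] }
    (fun φ => by
      rw [EuclideanSpace.norm_eq, EuclideanSpace.norm_eq]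
      congr 1
      have hsplit : ∀ f : Fin d → ℝ,
          ∑ l, f l = f i + (f j + ∑ l ∈ (Finset.univ.erase i).erase j, f l) := fun f => by
        rw [Finset.add_sum_erase _ _ (by simp [hij.symm]), Finset.add_sum_erase _ _ (by simp)]
      rw [hsplit, hsplit (fun l => ‖φ l‖ ^ 2), ← add_assoc, ← add_assoc]
      congr 1
      · simp only [LinearMap.coe_mk, AddHom.coe_mk, Function.update_self,
          Function.update_of_ne hij, ← Complex.normSq_eq_norm_sq, Complex.normSq_apply]
        simp only [Complex.add_re, Complex.add_im, Complex.mul_re, Complex.mul_im,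
          Complex.ofReal_re, Complex.ofReal_im, Complex.neg_re, Complex.neg_im]
        linear_combination ((φ i).re ^ 2 + (φ i).im ^ 2 + (φ j).re ^ 2 + (φ j).im ^ 2) *
          Real.sin_sq_add_cos_sq θ
      · refine Finset.sum_congr rfl fun l hl => ?_
        simp only [Finset.mem_erase] at hl
        simp [hl.1, hl.2.1])

theorem planeRotation_apply_left {d : ℕ} {i j : Fin d} (hij : i ≠ j) (θ : ℝ) (φ : Cvec d) :
    planeRotation hij θ φ i = Real.cos θ * φ i + Real.sin θ * φ j := by
  simp [planeRotation, hij]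

theorem planeRotation_apply_right {d : ℕ} {i j : Fin d} (hij : i ≠ j) (θ : ℝ) (φ : Cvec d) :
    planeRotation hij θ φ j = -Real.sin θ * φ i + Real.cos θ * φ j := by
  simp [planeRotation]

theorem planeRotation_apply_of_ne {d : ℕ} {i j l : Fin d} (hij : i ≠ j) (hi : l ≠ i)
    (hj : l ≠ j) (θ : ℝ) (φ : Cvec d) : planeRotation hij θ φ l = φ l := by
  simp [planeRotation, hi, hj]

theorem hasDerivAt_planeRotation_left {d : ℕ} {i j : Fin d} (hij : i ≠ j) (φ : Cvec d) (θ : ℝ) :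
    HasDerivAt (fun t => planeRotation hij t φ i) (planeRotation hij θ φ j) θ := by
  simp only [planeRotation_apply_left, planeRotation_apply_right]
  refine (((Real.hasDerivAt_cos θ).ofReal_comp.mul_const (φ i)).add
    ((Real.hasDerivAt_sin θ).ofReal_comp.mul_const (φ j))).congr_deriv ?_
  push_cast
  ring

theorem hasDerivAt_planeRotation_right {d : ℕ} {i j : Fin d} (hij : i ≠ j) (φ : Cvec d)
    (θ : ℝ) : HasDerivAt (fun t => planeRotation hij t φ j) (-planeRotation hij θ φ i) θ := by
  simp only [planeRotation_apply_left, planeRotation_apply_right]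
  refine (((Real.hasDerivAt_sin θ).ofReal_comp.neg.mul_const (φ i)).add
    ((Real.hasDerivAt_cos θ).ofReal_comp.mul_const (φ j))).congr_deriv ?_
  push_cast
  ring

theorem sphereMonomial_update_update {d : ℕ} {i j : Fin d} (hij : i ≠ j) (φ : Cvec d)
    (α : Fin d → ℕ) (a b : ℕ) :
    sphereMonomial φ (Function.update (Function.update α i a) j b) =
      (∏ l ∈ (Finset.univ.erase i).erase j, φ l ^ α l) * (φ i ^ a * φ j ^ b) := by
  rw [sphereMonomial, ← Finset.mul_prod_erase Finset.univ _ (Finset.mem_univ i),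
    ← Finset.mul_prod_erase (Finset.univ.erase i) _ (show j ∈ _ by simp [hij.symm])]
  rw [Function.update_of_ne hij, Function.update_self, Function.update_self, ← mul_assoc, mul_comm]
  congr 1
  refine Finset.prod_congr rfl fun l hl => ?_
  simp only [Finset.mem_erase] at hl
  simp [hl.1, hl.2.1]

theorem IsUniformOnSphere.integral_monomial_shift {d : ℕ} {μ : Measure (USphere d)}
    (hμ : IsUniformOnSphere d μ) {i j : Fin d} (hij : i ≠ j) (α : Fin d → ℕ) (a b : ℕ) :
    ((a : ℂ) + 1) * ∫ φ : USphere d,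
      sphereMonomial (φ : Cvec d) (Function.update (Function.update α i a) j (b + 1)) *
      star (sphereMonomial (φ : Cvec d) (Function.update (Function.update α i a) j (b + 1))) ∂μ =
    ((b : ℂ) + 1) * ∫ φ : USphere d,
      sphereMonomial (φ : Cvec d) (Function.update (Function.update α i (a + 1)) j b) *
      star (sphereMonomial (φ : Cvec d) (Function.update (Function.update α i (a + 1)) j b)) ∂μ := by
  have := hμ.1
  set M : ℕ → ℕ → Cvec d → ℂ := fun x y φ =>
    sphereMonomial φ (Function.update (Function.update α i x) j y) with hM
  have hMc : ∀ x y, Continuous (M x y) := fun x y => continuous_sphereMonomial _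
  have hzero : ∀ x y x' y', x ≠ x' → ∫ φ : USphere d, M x y φ * star (M x' y' φ) ∂μ = 0 := by
    intro x y x' y' hx
    refine hμ.integral_monomial_mul_star_of_ne fun h => hx ?_
    simpa [hij] using congrFun h i
  have hI : ∀ (c : ℂ) x y x' y',
      Integrable (fun φ : USphere d => c * (M x y φ * star (M x' y' φ))) μ := by
    intro c x y x' y'
    refine integrable_of_continuous_on_sphere ?_
    have := hMc x y
    have := hMc x' y'
    fun_prop
  have key := hμ.integral_deriv_eq_zero (planeRotation hij)
    (f := fun φ => M (a + 1) b φ * star (M a (b + 1) φ))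
    (f' := fun φ => ((a : ℂ) + 1) * (M a (b + 1) φ * star (M a (b + 1) φ)) +
      (-b : ℂ) * (M (a + 2) (b - 1) φ * star (M a (b + 1) φ)) +
      (a : ℂ) * (M (a + 1) b φ * star (M (a - 1) (b + 2) φ)) +
      (-((b : ℂ) + 1)) * (M (a + 1) b φ * star (M (a + 1) b φ)))
    ((hMc _ _).mul (hMc _ _).star)
    (by
      have := hMc a (b + 1)
      have := hMc (a + 2) (b - 1)
      have := hMc (a + 1) b
      have := hMc (a - 1) (b + 2)
      fun_prop)
    (by
      intro φ θ
      have hR : ∀ t, ∏ l ∈ (Finset.univ.erase i).erase j, planeRotation hij t φ l ^ α l =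
          ∏ l ∈ (Finset.univ.erase i).erase j, φ l ^ α l := by
        intro t
        refine Finset.prod_congr rfl fun l hl => ?_
        simp only [Finset.mem_erase] at hl
        rw [planeRotation_apply_of_ne hij hl.2.1 hl.1]
      simp only [hM, sphereMonomial_update_update hij, hR]
      have hu := hasDerivAt_planeRotation_left hij φ θ
      have hv := hasDerivAt_planeRotation_right hij φ θ
      refine ((((hu.pow (a + 1)).mul (hv.pow b)).const_mul _).mul
        ((((hu.pow a).mul (hv.pow (b + 1))).const_mul _).star)).congr_deriv ?_
      simp only [star_mul', star_add, star_neg, star_pow, star_natCast, Nat.add_sub_cancel,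
        Pi.mul_apply, Pi.pow_apply]
      push_cast
      ring)
  have hadd : ∀ f₁ f₂ f₃ f₄ : USphere d → ℂ, Integrable f₁ μ → Integrable f₂ μ →
      Integrable f₃ μ → Integrable f₄ μ → ∫ φ, f₁ φ + f₂ φ + f₃ φ + f₄ φ ∂μ =
        ∫ φ, f₁ φ ∂μ + ∫ φ, f₂ φ ∂μ + ∫ φ, f₃ φ ∂μ + ∫ φ, f₄ φ ∂μ := by
    intro f₁ f₂ f₃ f₄ h₁ h₂ h₃ h₄
    rw [integral_add (f := fun φ => f₁ φ + f₂ φ + f₃ φ) ((h₁.add h₂).add h₃) h₄,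
      integral_add (f := fun φ => f₁ φ + f₂ φ) (h₁.add h₂) h₃, integral_add h₁ h₂]
  rw [hadd _ _ _ _ (hI _ _ _ _ _) (hI _ _ _ _ _) (hI _ _ _ _ _) (hI _ _ _ _ _)] at key
  simp only [integral_const_mul] at key
  rw [hzero (a + 2) _ a _ (by omega), hzero (a + 1) _ (a - 1) _ (by omega)] at key
  linear_combination key

theorem sum_mul_star_self {d : ℕ} (φ : USphere d) :
    ∑ j, (φ : Cvec d) j * star ((φ : Cvec d) j) = 1 := by
  have h := EuclideanSpace.norm_sq_eq (φ : Cvec d)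
  rw [mem_sphere_zero_iff_norm.1 φ.2] at h
  simp only [Complex.star_def, Complex.mul_conj']
  exact_mod_cast (by simpa using h.symm)

/-- The rising factorial `d (d + 1) ⋯ (d + n - 1)`. -/
def risingFactorial (d n : ℕ) : ℝ := ∏ i ∈ Finset.range n, ((d : ℝ) + i)

theorem risingFactorial_pos {d : ℕ} (hd : 1 ≤ d) (n : ℕ) : 0 < risingFactorial d n :=
  Finset.prod_pos fun i _ => by positivity

theorem sphereMonomial_add_single {d : ℕ} (φ : Cvec d) (α : Fin d → ℕ) (i : Fin d) :
    sphereMonomial φ (α + Pi.single i 1) = φ i * sphereMonomial φ α := by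
  simp only [sphereMonomial, Pi.add_apply, pow_add, Finset.prod_mul_distrib]
  rw [mul_comm, Finset.prod_eq_single i]
  · simp
  · intro l _ hl
    simp [hl]
  · simp

theorem multiFactorial_add_single {ι : Type*} [Fintype ι] [DecidableEq ι] (α : ι → ℕ) (i : ι) :
    multiFactorial (α + Pi.single i 1) = (α i + 1) * multiFactorial α := by
  have h : ∀ l, ((α + Pi.single i 1 : ι → ℕ) l).factorial =
      (if l = i then α i + 1 else 1) * (α l).factorial := by
    intro l
    by_cases hl : l = i
    · subst hl; simp [Nat.factorial_succ]
    · simp [hl]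
  simp only [multiFactorial, h, Finset.prod_mul_distrib, Finset.prod_ite_eq', Finset.mem_univ,
    if_true]

theorem IsUniformOnSphere.integral_monomial_mul_star_self {d : ℕ} (hd : 1 ≤ d)
    {μ : Measure (USphere d)} (hμ : IsUniformOnSphere d μ) (n : ℕ) (α : Fin d → ℕ)
    (hα : ∑ l, α l = n) :
    ∫ φ : USphere d, sphereMonomial (φ : Cvec d) α * star (sphereMonomial (φ : Cvec d) α) ∂μ
      = ((multiFactorial α / risingFactorial d n : ℝ) : ℂ) := by
  have := hμ.1
  induction n generalizing α with
  | zero =>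
    obtain rfl : α = 0 := by
      ext l
      simpa using Finset.sum_eq_zero_iff.1 hα l (Finset.mem_univ l)
    simp [sphereMonomial, multiFactorial, risingFactorial]
  | succ n ih =>
    obtain ⟨i, hi⟩ : ∃ i, α i ≠ 0 := by
      by_contra! h
      simp [h] at hα
    obtain ⟨β, rfl⟩ : ∃ β : Fin d → ℕ, α = β + Pi.single i 1 := by
      refine ⟨α - Pi.single i 1, ?_⟩
      ext l
      by_cases hl : l = i
      · subst hl; simp; omega
      · simp [hl]
    have hβ : ∑ l, β l = n := by
      simpa [Finset.sum_add_distrib] using hα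
    set m : (Fin d → ℕ) → ℂ := fun γ => ∫ φ : USphere d,
      sphereMonomial (φ : Cvec d) γ * star (sphereMonomial (φ : Cvec d) γ) ∂μ with hm
    have hsum : ∑ j, m (β + Pi.single j 1) = m β := by
      rw [hm, ← integral_finsetSum]
      · refine integral_congr_ae (Filter.Eventually.of_forall fun φ => ?_)
        simp only [sphereMonomial_add_single, star_mul']
        calc _ = (∑ j, (φ : Cvec d) j * star ((φ : Cvec d) j)) *
            (sphereMonomial (φ : Cvec d) β * star (sphereMonomial (φ : Cvec d) β)) := by
              rw [Finset.sum_mul]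
              exact Finset.sum_congr rfl fun j _ => by ring
          _ = _ := by rw [sum_mul_star_self, one_mul]
      · intro j _
        exact integrable_of_continuous_on_sphere (by fun_prop)
    have hshift : ∀ j, ((β j : ℂ) + 1) * m (β + Pi.single i 1) =
        (β i + 1) * m (β + Pi.single j 1) := by
      intro j
      by_cases hij : i = j
      · subst hij; rfl
      · have h := hμ.integral_monomial_shift hij β (β i) (β j)
        have e1 : Function.update (Function.update β i (β i)) j (β j + 1) =
            β + Pi.single j 1 := by
          ext l
          by_cases hl : l = j
          · subst hl; simp
          · simp [hl]
        have e2 : Function.update (Function.update β i (β i + 1)) j (β j) =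
            β + Pi.single i 1 := by
          ext l
          by_cases hl : l = j
          · subst hl; simp [Ne.symm hij]
          · by_cases hl' : l = i
            · subst hl'; simp [hij]
            · simp [hl, hl']
        rw [e1, e2] at h
        exact h.symm
    have htot : ((n : ℂ) + d) * m (β + Pi.single i 1) = (β i + 1) * m β := by
      rw [← hsum, Finset.mul_sum, ← Finset.sum_congr rfl fun j _ => hshift j, ← Finset.sum_mul,
        Finset.sum_add_distrib, ← hβ]
      simp
    rw [hm] at htot
    simp only [ih β hβ] at htot
    have hne : (n : ℂ) + d ≠ 0 := by
      exact_mod_cast (by omega : n + d ≠ 0)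
    have hr : (risingFactorial d n : ℂ) ≠ 0 := by
      exact_mod_cast (risingFactorial_pos hd n).ne'
    have hr' : risingFactorial d (n + 1) = risingFactorial d n * (d + n) :=
      Finset.prod_range_succ _ _
    have hne' : (d : ℂ) + n ≠ 0 := by rwa [add_comm]
    apply mul_left_cancel₀ hne
    rw [htot, multiFactorial_add_single, hr']
    push_cast
    field_simp
    ring

/-- Evaluation of the homogeneous polynomial of degree `n` with coefficients `p`. -/
def homogEval {d : ℕ} (n : ℕ) (p : (Fin d → ℕ) → ℂ) (φ : Cvec d) : ℂ :=
  ∑ α ∈ multiDeg (Fin d) n, p α * sphereMonomial φ α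

@[fun_prop]
theorem continuous_homogEval {d : ℕ} (n : ℕ) (p : (Fin d → ℕ) → ℂ) :
    Continuous fun φ : Cvec d => homogEval n p φ := by
  unfold homogEval
  fun_prop

theorem homogEval_mul {d : ℕ} (m n : ℕ) (p q : (Fin d → ℕ) → ℂ) (φ : Cvec d) :
    homogEval m p φ * homogEval n q φ = homogEval (m + n) (coeffMul m n p q) φ := by
  have hmaps : ∀ x ∈ multiDeg (Fin d) m ×ˢ multiDeg (Fin d) n,
      x.1 + x.2 ∈ multiDeg (Fin d) (m + n) := by
    intro x hx
    simp only [Finset.mem_product, mem_multiDeg] at hx ⊢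
    simp [Finset.sum_add_distrib, hx]
  simp only [homogEval, coeffMul]
  rw [Finset.sum_mul_sum, ← Finset.sum_product', ← Finset.sum_fiberwise_of_maps_to hmaps]
  refine Finset.sum_congr rfl fun γ _ => ?_
  rw [Finset.sum_mul]
  refine Finset.sum_congr rfl fun x hx => ?_
  rw [← (Finset.mem_filter.1 hx).2]
  simp only [sphereMonomial, Pi.add_apply, pow_add, Finset.prod_mul_distrib]
  ring

theorem IsUniformOnSphere.integral_normSq_homogEval {d : ℕ} (hd : 1 ≤ d)
    {μ : Measure (USphere d)} (hμ : IsUniformOnSphere d μ) (n : ℕ) (p : (Fin d → ℕ) → ℂ) :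
    ∫ φ : USphere d, ‖homogEval n p (φ : Cvec d)‖ ^ 2 ∂μ =
      (∑ α ∈ multiDeg (Fin d) n, multiFactorial α * ‖p α‖ ^ 2) / risingFactorial d n := by
  have := hμ.1
  apply Complex.ofReal_injective
  rw [← integral_complex_ofReal]
  have hexp : ∀ φ : USphere d, ((‖homogEval n p (φ : Cvec d)‖ ^ 2 : ℝ) : ℂ) =
      ∑ α ∈ multiDeg (Fin d) n, ∑ β ∈ multiDeg (Fin d) n, p α * star (p β) *
        (sphereMonomial (φ : Cvec d) α * star (sphereMonomial (φ : Cvec d) β)) := by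
    intro φ
    push_cast
    rw [← Complex.mul_conj', homogEval, map_sum, Finset.sum_mul_sum]
    refine Finset.sum_congr rfl fun α _ => Finset.sum_congr rfl fun β _ => ?_
    rw [map_mul, Complex.star_def]
    ring
  simp only [hexp]
  rw [integral_finsetSum _ fun α _ => integrable_of_continuous_on_sphere (by fun_prop)]
  push_cast
  rw [Finset.sum_div]
  refine Finset.sum_congr rfl fun α hα => ?_
  rw [integral_finsetSum _ fun α _ => integrable_of_continuous_on_sphere (by fun_prop),
    Finset.sum_eq_single α]
  · rw [integral_const_mul, hμ.integral_monomial_mul_star_self hd n α (mem_multiDeg.1 hα),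
      Complex.star_def, Complex.mul_conj']
    push_cast
    ring
  · intro β _ hβ
    rw [integral_const_mul, hμ.integral_monomial_mul_star_of_ne hβ.symm, mul_zero]
  · exact fun h => absurd hα h

theorem risingFactorial_add_le {d : ℕ} (hd : 1 ≤ d) (k : ℕ) :
    risingFactorial d (k + k) ≤ Real.exp ((k : ℝ) ^ 2 / d) * risingFactorial d k ^ 2 := by
  have hd' : (0 : ℝ) < d := by exact_mod_cast hd
  have h : ∏ i ∈ Finset.range k, ((d : ℝ) + (k + i : ℕ)) ≤
      ∏ i ∈ Finset.range k, (Real.exp (k / d) * ((d : ℝ) + i)) := by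
    refine Finset.prod_le_prod (fun i _ => by positivity) fun i _ => ?_
    have h1 := Real.add_one_le_exp ((k : ℝ) / d)
    refine le_trans ?_ (mul_le_mul_of_nonneg_right h1 (by positivity))
    have h2 : ((k : ℝ) / d + 1) * (d + i) = d + k + i + k * i / d := by
      field_simp
      ring
    rw [h2]
    push_cast
    have : (0 : ℝ) ≤ k * i / d := by positivity
    linarith
  rw [Finset.prod_mul_distrib, Finset.prod_const, Finset.card_range, ← Real.exp_nat_mul,
    show (k : ℝ) * (k / d) = (k : ℝ) ^ 2 / d by ring] at h
  calc risingFactorial d (k + k)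
      = risingFactorial d k * ∏ i ∈ Finset.range k, ((d : ℝ) + (k + i : ℕ)) :=
        Finset.prod_range_add _ _ _
    _ ≤ risingFactorial d k * (Real.exp ((k : ℝ) ^ 2 / d) * risingFactorial d k) :=
        mul_le_mul_of_nonneg_left h (risingFactorial_pos hd k).le
    _ = _ := by ring

theorem IsUniformOnSphere.integral_mul_integral_le {d : ℕ} (hd : 1 ≤ d)
    {μ : Measure (USphere d)} (hμ : IsUniformOnSphere d μ) (k : ℕ) (p q : (Fin d → ℕ) → ℂ) :
    (∫ φ : USphere d, ‖homogEval k p (φ : Cvec d)‖ ^ 2 ∂μ) *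
        ∫ φ : USphere d, ‖homogEval k q (φ : Cvec d)‖ ^ 2 ∂μ ≤
      Real.exp ((k : ℝ) ^ 2 / d) * ∫ φ : USphere d,
        ‖homogEval k p (φ : Cvec d)‖ ^ 2 * ‖homogEval k q (φ : Cvec d)‖ ^ 2 ∂μ := by
  simp only [← mul_pow, ← norm_mul, homogEval_mul]
  simp only [hμ.integral_normSq_homogEval hd]
  have h1 := risingFactorial_pos hd k
  have h2 := risingFactorial_pos hd (k + k)
  have hb := bombieri_inequality k k p q
  have hr := risingFactorial_add_le hd k
  rw [div_mul_div_comm, ← mul_div_assoc, div_le_div_iff₀ (by positivity) h2]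
  calc _ ≤ (∑ γ ∈ multiDeg (Fin d) (k + k),
        (multiFactorial γ : ℝ) * ‖coeffMul k k p q γ‖ ^ 2) *
          (Real.exp ((k : ℝ) ^ 2 / d) * risingFactorial d k ^ 2) :=
        mul_le_mul hb hr h2.le (Finset.sum_nonneg fun γ _ => by positivity)
    _ = _ := by ring

/-- The tensor power `φ^{⊗k}`. -/
def vecPow (d k : ℕ) (φ : Cvec d) : (Fin k → Fin d) → ℂ := fun i => ∏ a, φ (i a)

theorem ketbraPow_eq_vecMulVec (d k : ℕ) (φ : Cvec d) :
    ketbraPow d k φ = Matrix.vecMulVec (vecPow d k φ) (star (vecPow d k φ)) := by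
  ext i j
  simp [ketbraPow, vecPow, Matrix.vecMulVec_apply, Finset.prod_mul_distrib]

/-- The number of occurrences of each index in a tuple. -/
def tupleCount {d k : ℕ} (i : Fin k → Fin d) (l : Fin d) : ℕ :=
  (Finset.univ.filter fun a => i a = l).card

theorem tupleCount_mem_multiDeg {d k : ℕ} (i : Fin k → Fin d) :
    tupleCount i ∈ multiDeg (Fin d) k := by
  rw [mem_multiDeg]
  simp only [tupleCount]
  rw [← Finset.card_eq_sum_card_fiberwise fun _ _ => Finset.mem_coe.2 (Finset.mem_univ _)]
  simp

theorem vecPow_eq_sphereMonomial {d k : ℕ} (φ : Cvec d) (i : Fin k → Fin d) :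
    vecPow d k φ i = sphereMonomial φ (tupleCount i) := by
  rw [vecPow, ← Finset.prod_fiberwise' Finset.univ i (fun l => φ l)]
  simp [sphereMonomial, tupleCount]

theorem exists_dotProduct_vecPow_eq_homogEval {d k : ℕ} (v : (Fin k → Fin d) → ℂ) :
    ∃ p : (Fin d → ℕ) → ℂ, ∀ φ : Cvec d, v ⬝ᵥ vecPow d k φ = homogEval k p φ := by
  refine ⟨fun α => ∑ i with tupleCount i = α, v i, fun φ => ?_⟩
  rw [dotProduct, homogEval, ← Finset.sum_fiberwise_of_maps_to
    (g := tupleCount) (t := multiDeg (Fin d) k) fun i _ => tupleCount_mem_multiDeg i]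
  refine Finset.sum_congr rfl fun α _ => ?_
  rw [Finset.sum_mul]
  refine Finset.sum_congr rfl fun i hi => ?_
  rw [vecPow_eq_sphereMonomial, (Finset.mem_filter.1 hi).2]

theorem Matrix.PosSemidef.exists_trace_mul_ketbraPow_eq {d k : ℕ}
    {A : Matrix (Fin k → Fin d) (Fin k → Fin d) ℂ} (hA : A.PosSemidef) :
    ∃ (m : ℕ) (p : Fin m → (Fin d → ℕ) → ℂ), ∀ φ : Cvec d,
      (A * ketbraPow d k φ).trace = ((∑ s, ‖homogEval k (p s) φ‖ ^ 2 : ℝ) : ℂ) := by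
  obtain ⟨m, v, rfl⟩ := Matrix.posSemidef_iff_eq_sum_vecMulVec.1 hA
  choose p hp using fun s => exists_dotProduct_vecPow_eq_homogEval (star (v s))
  refine ⟨m, p, fun φ => ?_⟩
  rw [ketbraPow_eq_vecMulVec, Finset.sum_mul, Matrix.trace_sum]
  push_cast
  refine Finset.sum_congr rfl fun s _ => ?_
  rw [Matrix.vecMulVec_mul_vecMulVec, Matrix.trace_vecMulVec, dotProduct_smul, hp,
    ← Complex.mul_conj', smul_eq_mul, ← hp, ← Complex.star_def, Matrix.star_dotProduct, star_star,
    dotProduct_comm (v s)]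

theorem trace_ketbraPow {d : ℕ} (k : ℕ) (φ : USphere d) :
    (ketbraPow d k (φ : Cvec d)).trace = 1 := by
  simp only [Matrix.trace, Matrix.diag_apply, ketbraPow]
  rw [← Fintype.piFinset_univ, Finset.sum_prod_piFinset Finset.univ
    fun (_ : Fin k) l => (φ : Cvec d) l * star ((φ : Cvec d) l), sum_mul_star_self]
  simp

open scoped Kronecker

theorem trace_mul_kronecker_ketbraPow_le_one {d k : ℕ}
    {M : Matrix ((Fin k → Fin d) × (Fin k → Fin d)) ((Fin k → Fin d) × (Fin k → Fin d)) ℂ}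
    (hM : (1 - M).PosSemidef) (φ ψ : USphere d) :
    (M * (ketbraPow d k (φ : Cvec d) ⊗ₖ ketbraPow d k (ψ : Cvec d))).trace.re ≤ 1 := by
  set w : (Fin k → Fin d) × (Fin k → Fin d) → ℂ :=
    fun i => vecPow d k (φ : Cvec d) i.1 * vecPow d k (ψ : Cvec d) i.2 with hw
  have hkron : ketbraPow d k (φ : Cvec d) ⊗ₖ ketbraPow d k (ψ : Cvec d) =
      Matrix.vecMulVec w (star w) := by
    ext i j
    simp only [ketbraPow_eq_vecMulVec, Matrix.kroneckerMap_apply, Matrix.vecMulVec_apply, hw,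
      Pi.star_apply, star_mul']
    ring
  have hnonneg := hM.dotProduct_mulVec_nonneg w
  rw [dotProduct_comm, ← Matrix.trace_vecMulVec, ← Matrix.mul_vecMulVec, ← hkron, sub_mul,
    one_mul, Matrix.trace_sub, Matrix.trace_kronecker, trace_ketbraPow, trace_ketbraPow] at hnonneg
  have hre := (Complex.le_def.1 hnonneg).1
  simp only [Complex.zero_re, Complex.sub_re, Complex.mul_re, Complex.one_re, Complex.one_im]
    at hre
  linarith


/-- Lower bound for DIPE against separable measurements: if a separable
two-outcome POVM `{M, I−M}` with `M = Σ_t A_t ⊗ B_t` distinguishes i.i.d. pairs of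
independent random states from pairs of identical random states with advantage `≥ 1/3`,
then `e^{k²/d} − 1 ≥ 1/3`. -/
theorem stmt7 (d k : ℕ) (hd : 1 ≤ d) (hk : 1 ≤ k)
    (μ : Measure (USphere d)) (hμ : IsUniformOnSphere d μ)
    (T : Type) [Fintype T]
    (A B : T → Matrix (Fin k → Fin d) (Fin k → Fin d) ℂ)
    (hA : ∀ t, (A t).PosSemidef) (hB : ∀ t, (B t).PosSemidef)
    (hM : (1 - ∑ t, A t ⊗ₖ B t).PosSemidef)
    (hgap :
      (∫ φ : USphere d, ∫ ψ : USphere d,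
          Complex.re (((∑ t, A t ⊗ₖ B t) *
            (ketbraPow d k (↑φ) ⊗ₖ ketbraPow d k (↑ψ))).trace) ∂μ ∂μ)
        - (∫ φ : USphere d,
            Complex.re (((∑ t, A t ⊗ₖ B t) *
              (ketbraPow d k (↑φ) ⊗ₖ ketbraPow d k (↑φ))).trace) ∂μ)
        ≥ 1 / 3) :
    Real.exp ((k : ℝ) ^ 2 / d) - 1 ≥ 1 / 3 := by
  have := hμ.1
  choose m p hp using fun t => (hA t).exists_trace_mul_ketbraPow_eq
  choose n q hq using fun t => (hB t).exists_trace_mul_ketbraPow_eq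
  have htr : ∀ φ ψ : Cvec d, Complex.re (((∑ t, A t ⊗ₖ B t) *
      (ketbraPow d k φ ⊗ₖ ketbraPow d k ψ)).trace) =
      ∑ t, ∑ s, ∑ u, ‖homogEval k (p t s) φ‖ ^ 2 * ‖homogEval k (q t u) ψ‖ ^ 2 := by
    intro φ ψ
    simp only [Finset.sum_mul, Matrix.trace_sum, ← Matrix.mul_kronecker_mul,
      Matrix.trace_kronecker, hp, hq, Complex.re_sum, ← Complex.ofReal_mul, Complex.ofReal_re]
    exact Finset.sum_congr rfl fun t _ => by rw [← Finset.sum_mul, Finset.sum_mul_sum]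
  have hle := fun φ ψ : USphere d => trace_mul_kronecker_ketbraPow_le_one hM φ ψ
  simp only [htr] at hgap hle
  have hinner : ∀ φ : USphere d, ∫ ψ : USphere d, ∑ t, ∑ s, ∑ u,
      ‖homogEval k (p t s) φ‖ ^ 2 * ‖homogEval k (q t u) ψ‖ ^ 2 ∂μ =
      ∑ t, ∑ s, ∑ u, ‖homogEval k (p t s) φ‖ ^ 2 *
        ∫ ψ : USphere d, ‖homogEval k (q t u) ψ‖ ^ 2 ∂μ := by
    intro φ
    rw [integral_finsetSum _ fun _ _ => integrable_of_continuous_on_sphere (by fun_prop)]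
    refine Finset.sum_congr rfl fun t _ => ?_
    rw [integral_finsetSum _ fun _ _ => integrable_of_continuous_on_sphere (by fun_prop)]
    refine Finset.sum_congr rfl fun s _ => ?_
    rw [integral_finsetSum _ fun _ _ => integrable_of_continuous_on_sphere (by fun_prop)]
    exact Finset.sum_congr rfl fun u _ => integral_const_mul _ _
  have hind_le : ∫ φ : USphere d, ∫ ψ : USphere d, ∑ t, ∑ s, ∑ u,
      ‖homogEval k (p t s) φ‖ ^ 2 * ‖homogEval k (q t u) ψ‖ ^ 2 ∂μ ∂μ ≤ 1 := by
    have hφ : ∀ φ : USphere d, ∫ ψ : USphere d, ∑ t, ∑ s, ∑ u,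
        ‖homogEval k (p t s) φ‖ ^ 2 * ‖homogEval k (q t u) ψ‖ ^ 2 ∂μ ≤ 1 := by
      intro φ
      have hint : Integrable (fun ψ : USphere d => ∑ t, ∑ s, ∑ u,
          ‖homogEval k (p t s) φ‖ ^ 2 * ‖homogEval k (q t u) ψ‖ ^ 2) μ :=
        integrable_of_continuous_on_sphere (by fun_prop)
      simpa using integral_mono hint (integrable_const (1 : ℝ)) (hle φ)
    have hint : Integrable (fun φ : USphere d => ∫ ψ : USphere d, ∑ t, ∑ s, ∑ u,
        ‖homogEval k (p t s) φ‖ ^ 2 * ‖homogEval k (q t u) ψ‖ ^ 2 ∂μ) μ := by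
      simp only [hinner]
      exact integrable_of_continuous_on_sphere (by fun_prop)
    simpa using integral_mono hint (integrable_const (1 : ℝ)) hφ
  have hcompare : ∫ φ : USphere d, ∫ ψ : USphere d, ∑ t, ∑ s, ∑ u,
      ‖homogEval k (p t s) φ‖ ^ 2 * ‖homogEval k (q t u) ψ‖ ^ 2 ∂μ ∂μ ≤
      Real.exp ((k : ℝ) ^ 2 / d) * ∫ φ : USphere d, ∑ t, ∑ s, ∑ u,
        ‖homogEval k (p t s) φ‖ ^ 2 * ‖homogEval k (q t u) φ‖ ^ 2 ∂μ := by
    simp only [hinner]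
    rw [integral_finsetSum _ fun _ _ => integrable_of_continuous_on_sphere (by fun_prop),
      integral_finsetSum _ fun _ _ => integrable_of_continuous_on_sphere (by fun_prop),
      Finset.mul_sum]
    refine Finset.sum_le_sum fun t _ => ?_
    rw [integral_finsetSum _ fun _ _ => integrable_of_continuous_on_sphere (by fun_prop),
      integral_finsetSum _ fun _ _ => integrable_of_continuous_on_sphere (by fun_prop),
      Finset.mul_sum]
    refine Finset.sum_le_sum fun s _ => ?_
    rw [integral_finsetSum _ fun _ _ => integrable_of_continuous_on_sphere (by fun_prop),
      integral_finsetSum _ fun _ _ => integrable_of_continuous_on_sphere (by fun_prop),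
      Finset.mul_sum]
    refine Finset.sum_le_sum fun u _ => ?_
    rw [integral_mul_const]
    exact hμ.integral_mul_integral_le hd k (p t s) (q t u)
  have hexp : 1 ≤ Real.exp ((k : ℝ) ^ 2 / d) := Real.one_le_exp (by positivity)
  nlinarith

end
end

section
/- Let d ≥ 1 and let A, B, C be Hermitian d×d complex matrices. Then: (i) d(d+1) · ∫ ⟨ψ, Aψ⟩·⟨ψ, Bψ⟩ dμ_d(ψ) = Tr(A)·Tr(B) + Tr(AB); and (ii) d(d+1)(d+2) · ∫ ⟨ψ, Aψ⟩·⟨ψ, Bψ⟩·⟨ψ, Cψ⟩ dμ_d(ψ) = Tr(A)Tr(B)Tr(C) + Tr(AB)Tr(C) + Tr(AC)Tr(B) + Tr(BC)Tr(A) + Tr(ABC) + Tr(ACB). -/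
open MeasureTheory

noncomputable section

/-- The quadratic form `⟨ψ, Aψ⟩ = Σ_{i,j} conj(ψ_i) A_{ij} ψ_j`. -/
def qForm (d : ℕ) (A : Matrix (Fin d) (Fin d) ℂ) (ψ : Cvec d) : ℂ :=
  ∑ i : Fin d, ∑ j : Fin d, star (ψ i) * A i j * ψ j

lemma qForm_eq_dotProduct {d : ℕ} (A : Matrix (Fin d) (Fin d) ℂ) (ψ : Cvec d) :
    qForm d A ψ = star ψ.ofLp ⬝ᵥ A.mulVec ψ.ofLp := by
  simp [qForm, dotProduct, Matrix.mulVec, Finset.mul_sum, mul_assoc]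

lemma qForm_eq_inner {d : ℕ} (A : Matrix (Fin d) (Fin d) ℂ) (ψ : Cvec d) :
    qForm d A ψ = inner ℂ ψ (Matrix.toEuclideanCLM (𝕜 := ℂ) A ψ) := by
  rw [qForm_eq_dotProduct, EuclideanSpace.inner_eq_star_dotProduct, dotProduct_comm]
  rfl

/-- For fixed `ψ`, the quadratic form is linear in the matrix. -/
def qFormLinear (d : ℕ) (ψ : Cvec d) : Matrix (Fin d) (Fin d) ℂ →ₗ[ℂ] ℂ where
  toFun A := qForm d A ψ
  map_add' A B := by simp [qForm_eq_dotProduct, Matrix.add_mulVec]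
  map_smul' c A := by simp [qForm_eq_dotProduct, Matrix.smul_mulVec]

@[simp]
lemma qFormLinear_apply {d : ℕ} (ψ : Cvec d) (A : Matrix (Fin d) (Fin d) ℂ) :
    qFormLinear d ψ A = qForm d A ψ := rfl

@[fun_prop]
lemma continuous_qForm {d : ℕ} (A : Matrix (Fin d) (Fin d) ℂ) :
    Continuous fun ψ : USphere d => qForm d A ψ := by
  unfold qForm
  fun_prop

lemma qForm_one {d : ℕ} (ψ : USphere d) : qForm d 1 ψ = 1 := by
  rw [qForm_eq_inner, map_one, one_apply_eq_self, inner_self_eq_norm_sq_to_K,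
    mem_sphere_zero_iff_norm.mp ψ.2]
  simp

lemma continuous_sphereRot {d : ℕ} (e : Cvec d ≃ₗᵢ[ℂ] Cvec d) : Continuous (sphereRot d e) :=
  (e.continuous.comp continuous_subtype_val).subtype_mk _

lemma qForm_toEuclideanCLM_apply {d : ℕ} (A U : Matrix (Fin d) (Fin d) ℂ) (ψ : Cvec d) :
    qForm d A (Matrix.toEuclideanCLM (𝕜 := ℂ) U ψ) = qForm d (star U * A * U) ψ := by
  rw [qForm_eq_inner, qForm_eq_inner, map_mul, map_mul, map_star, mul_apply_eq_comp,
    mul_apply_eq_comp, ContinuousLinearMap.star_eq_adjoint,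
    ContinuousLinearMap.adjoint_inner_right]

lemma integrable_of_continuous_sphere {d : ℕ} {μ : Measure (USphere d)} [IsFiniteMeasure μ]
    {f : USphere d → ℂ} (hf : Continuous f) : Integrable f μ :=
  hf.integrable_of_hasCompactSupport (HasCompactSupport.of_compactSpace f)

lemma integral_sphere_unitary {d : ℕ} {μ : Measure (USphere d)} (hμ : IsUniformOnSphere d μ)
    {ι : Type*} [Fintype ι] (A : ι → Matrix (Fin d) (Fin d) ℂ)
    {U : Matrix (Fin d) (Fin d) ℂ} (hU : U ∈ unitary (Matrix (Fin d) (Fin d) ℂ)) :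
    ∫ ψ : USphere d, ∏ i, qForm d (star U * A i * U) ψ ∂μ
      = ∫ ψ : USphere d, ∏ i, qForm d (A i) ψ ∂μ := by
  let V : unitary (Cvec d →L[ℂ] Cvec d) :=
    ⟨Matrix.toEuclideanCLM (𝕜 := ℂ) U, Unitary.map_mem Matrix.toEuclideanCLM hU⟩
  let e : Cvec d ≃ₗᵢ[ℂ] Cvec d := Unitary.linearIsometryEquiv V
  have h : ∀ ψ : USphere d, ∏ i, qForm d (star U * A i * U) ψ
      = ∏ i, qForm d (A i) (sphereRot d e ψ) := fun ψ =>
    Finset.prod_congr rfl fun i _ => (qForm_toEuclideanCLM_apply (A i) U ψ).symm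
  have hc : Continuous fun ψ : USphere d => ∏ i, qForm d (A i) ψ :=
    continuous_finsetProd _ fun i _ => continuous_qForm (A i)
  simp_rw [h]
  conv_rhs => rw [← hμ.2 e]
  exact (integral_map (continuous_sphereRot e).aemeasurable hc.aestronglyMeasurable).symm

/-- The moment of a family of quadratic forms, as a multilinear map in the matrices. -/
def sphereMoment {d : ℕ} (μ : Measure (USphere d)) [IsProbabilityMeasure μ]
    (ι : Type*) [Fintype ι] :
    MultilinearMap ℂ (fun _ : ι => Matrix (Fin d) (Fin d) ℂ) ℂ where
  toFun A := ∫ ψ : USphere d, ∏ i, qForm d (A i) ψ ∂μ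
  map_update_add' A i X Y := by
    rw [← integral_add]
    · congr 1 with ψ
      exact ((MultilinearMap.mkPiAlgebra ℂ ι ℂ).compLinearMap
        fun _ => qFormLinear d ψ).map_update_add A i X Y
    all_goals
      exact integrable_of_continuous_sphere
        (continuous_finsetProd _ fun i _ => continuous_qForm _)
  map_update_smul' A i c X := by
    rw [smul_eq_mul, ← integral_const_mul]
    congr 1 with ψ
    exact ((MultilinearMap.mkPiAlgebra ℂ ι ℂ).compLinearMap
      fun _ => qFormLinear d ψ).map_update_smul A i c X

section Derivative

open scoped Matrix.Norms.L2Operator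

lemma norm_qForm_le {d : ℕ} (A : Matrix (Fin d) (Fin d) ℂ) (ψ : USphere d) :
    ‖qForm d A ψ‖ ≤ ‖A‖ := by
  have hψ : ‖(ψ : Cvec d)‖ = 1 := mem_sphere_zero_iff_norm.mp ψ.2
  rw [qForm_eq_inner]
  refine (norm_inner_le_norm _ _).trans ?_
  have := (Matrix.toEuclideanCLM (𝕜 := ℂ) A).le_opNorm ψ
  rw [Matrix.l2_opNorm_toEuclideanCLM, hψ, mul_one] at this
  rwa [hψ, one_mul]

lemma norm_sphereMoment_le {d : ℕ} (μ : Measure (USphere d)) [IsProbabilityMeasure μ]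
    {ι : Type*} [Fintype ι] (A : ι → Matrix (Fin d) (Fin d) ℂ) :
    ‖sphereMoment μ ι A‖ ≤ 1 * ∏ i, ‖A i‖ := by
  have := norm_integral_le_of_norm_le_const (μ := μ)
    (f := fun ψ : USphere d => ∏ i, qForm d (A i) ψ) (C := ∏ i, ‖A i‖)
    (Filter.Eventually.of_forall fun ψ => by
      rw [norm_prod]
      exact Finset.prod_le_prod (fun _ _ => norm_nonneg _) fun i _ => norm_qForm_le _ _)
  simpa [sphereMoment] using this

lemma sum_sphereMoment_commutator_of_skewAdjoint {d : ℕ} {μ : Measure (USphere d)}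
    [IsProbabilityMeasure μ] (hμ : IsUniformOnSphere d μ) {ι : Type*} [Fintype ι] [DecidableEq ι]
    (A : ι → Matrix (Fin d) (Fin d) ℂ) {X : Matrix (Fin d) (Fin d) ℂ} (hX : star X = -X) :
    ∑ i, sphereMoment μ ι (Function.update A i (A i * X - X * A i)) = 0 := by
  let M := (sphereMoment μ ι).mkContinuous 1 (norm_sphereMoment_le μ)
  let γ : ℝ → ι → Matrix (Fin d) (Fin d) ℂ := fun t i =>
    NormedSpace.exp (t • -X) * A i * NormedSpace.exp (t • X)
  have hγ : HasDerivAt γ (fun i => A i * X - X * A i) 0 := by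
    refine hasDerivAt_pi.mpr fun i => ?_
    have h := ((hasDerivAt_exp_smul_const (𝕂 := ℝ) (-X) 0).mul_const (A i)).mul
      (hasDerivAt_exp_smul_const (𝕂 := ℝ) X 0)
    refine h.congr_deriv ?_
    simp only [zero_smul, NormedSpace.exp_zero, one_mul, mul_one]
    noncomm_ring
  have hγ0 : γ 0 = A := by ext1 i; simp [γ]
  have hM : HasDerivAt (fun t => M (γ t)) (M.linearDeriv (γ 0) fun i => A i * X - X * A i) 0 :=
    ((M.hasFDerivAt (γ 0)).restrictScalars ℝ).comp_hasDerivAt 0 hγ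
  have hconst : (fun t => M (γ t)) = fun _ => M A := by
    ext1 t
    let _ : NormedAlgebra ℚ (Matrix (Fin d) (Fin d) ℂ) := NormedAlgebra.restrictScalars ℚ ℝ _
    have hU : NormedSpace.exp (t • X) ∈ unitary (Matrix (Fin d) (Fin d) ℂ) :=
      NormedSpace.exp_mem_unitary_of_mem_skewAdjoint
        (by rw [skewAdjoint.mem_iff, star_smul, hX]; simp)
    have := integral_sphere_unitary hμ A hU
    rw [NormedSpace.star_exp, star_smul, hX] at this
    simpa [M, γ, sphereMoment] using this
  rw [hconst, hγ0] at hM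
  have := hM.unique (hasDerivAt_const 0 _)
  rwa [ContinuousMultilinearMap.linearDeriv_apply] at this

end Derivative

lemma sum_sphereMoment_commutator {d : ℕ} {μ : Measure (USphere d)}
    [IsProbabilityMeasure μ] (hμ : IsUniformOnSphere d μ) {ι : Type*} [Fintype ι] [DecidableEq ι]
    (A : ι → Matrix (Fin d) (Fin d) ℂ) (X : Matrix (Fin d) (Fin d) ℂ) :
    ∑ i, sphereMoment μ ι (Function.update A i (A i * X - X * A i)) = 0 := by
  have h₁ := sum_sphereMoment_commutator_of_skewAdjoint hμ A (X := X - star X) (by simp)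
  have h₂ := sum_sphereMoment_commutator_of_skewAdjoint hμ A
    (X := Complex.I • (X + star X)) (by simp [add_comm])
  have key : ∀ i, A i * X - X * A i
      = (1 / 2 : ℂ) • (A i * (X - star X) - (X - star X) * A i)
        + (-Complex.I / 2) • (A i * (Complex.I • (X + star X))
          - (Complex.I • (X + star X)) * A i) := fun i => by
    simp only [mul_smul_comm, smul_mul_assoc, ← smul_sub, smul_smul]
    have : -Complex.I / 2 * Complex.I = 1 / 2 := by
      linear_combination (-1 / 2 : ℂ) * Complex.I_mul_I
    rw [this, ← smul_add, mul_sub, sub_mul, mul_add, add_mul]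
    module
  simp_rw [key, MultilinearMap.map_update_add, MultilinearMap.map_update_smul,
    Finset.sum_add_distrib, ← Finset.smul_sum, h₁, h₂]
  simp

lemma integral_qForm_commutator {d : ℕ} {μ : Measure (USphere d)}
    [IsProbabilityMeasure μ] (hμ : IsUniformOnSphere d μ) (A B C X : Matrix (Fin d) (Fin d) ℂ) :
    ∫ ψ : USphere d, (qForm d (A * X - X * A) ψ * qForm d B ψ * qForm d C ψ
      + qForm d A ψ * qForm d (B * X - X * B) ψ * qForm d C ψ
      + qForm d A ψ * qForm d B ψ * qForm d (C * X - X * C) ψ) ∂μ = 0 := by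
  have h := sum_sphereMoment_commutator hμ ![A, B, C] X
  rw [integral_add, integral_add]
  · simpa [sphereMoment, Fin.sum_univ_three, Fin.prod_univ_three,
      -MultilinearMap.map_update_sub] using h
  all_goals exact integrable_of_continuous_sphere (by fun_prop)

lemma qForm_mul_single {d : ℕ} (A : Matrix (Fin d) (Fin d) ℂ) (a b : Fin d) (ψ : Cvec d) :
    qForm d (A * Matrix.single b a 1) ψ = Matrix.vecMul (star ψ.ofLp) A b * ψ a := by
  rw [qForm_eq_dotProduct, ← Matrix.mulVec_mulVec, Matrix.dotProduct_mulVec,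
    Matrix.single_mulVec_eq]
  simp [mul_comm]

lemma qForm_single_mul {d : ℕ} (A : Matrix (Fin d) (Fin d) ℂ) (a b : Fin d) (ψ : Cvec d) :
    qForm d (Matrix.single a b 1 * A) ψ = star (ψ a) * A.mulVec ψ.ofLp b := by
  rw [qForm_eq_dotProduct, ← Matrix.mulVec_mulVec, Matrix.single_mulVec_eq]
  simp [mul_comm]

lemma qForm_sub {d : ℕ} (A B : Matrix (Fin d) (Fin d) ℂ) (ψ : Cvec d) :
    qForm d (A - B) ψ = qForm d A ψ - qForm d B ψ :=
  (qFormLinear d ψ).map_sub A B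

lemma sum_vecMul_mul {d : ℕ} (A : Matrix (Fin d) (Fin d) ℂ) (ψ : Cvec d) :
    ∑ b, Matrix.vecMul (star ψ.ofLp) A b * ψ b = qForm d A ψ := by
  rw [qForm_eq_dotProduct, Matrix.dotProduct_mulVec]
  rfl

lemma sum_star_mul_self {d : ℕ} (ψ : USphere d) :
    ∑ a, star ((ψ : Cvec d) a) * (ψ : Cvec d) a = 1 := by
  have h := qForm_one ψ
  rw [qForm_eq_dotProduct, Matrix.one_mulVec] at h
  exact h

lemma sum_qForm_commutator_single {d : ℕ} (A : Matrix (Fin d) (Fin d) ℂ) (ψ : USphere d) :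
    ∑ a, ∑ b, qForm d (A * Matrix.single b a 1 * Matrix.single a b 1
        - Matrix.single a b 1 * (A * Matrix.single b a 1)) ψ
      = d * qForm d A ψ - A.trace := by
  have h₁ : ∀ a b : Fin d, qForm d (A * Matrix.single b a 1 * Matrix.single a b 1) ψ
      = Matrix.vecMul (star (ψ : Cvec d).ofLp) A b * (ψ : Cvec d) b := fun a b => by
    rw [mul_assoc, Matrix.single_mul_single_same, mul_one, qForm_mul_single]
  have h₂ : ∀ a b : Fin d, qForm d (Matrix.single a b 1 * (A * Matrix.single b a 1)) ψ
      = A b b * (star ((ψ : Cvec d) a) * (ψ : Cvec d) a) := fun a b => by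
    rw [qForm_single_mul, ← Matrix.mulVec_mulVec, Matrix.single_mulVec_eq]
    simp [Matrix.mulVec_smul]
    ring
  simp_rw [qForm_sub, h₁, h₂, Finset.sum_sub_distrib, sum_vecMul_mul, ← Finset.sum_mul]
  rw [← Finset.mul_sum, sum_star_mul_self]
  simp [Matrix.trace]

lemma sum_qForm_mul_single_mul_commutator {d : ℕ} (A B : Matrix (Fin d) (Fin d) ℂ)
    (ψ : USphere d) :
    ∑ a, ∑ b, qForm d (A * Matrix.single b a 1) ψ
        * qForm d (B * Matrix.single a b 1 - Matrix.single a b 1 * B) ψ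
      = qForm d A ψ * qForm d B ψ - qForm d (A * B) ψ := by
  have h : ∀ a b : Fin d, qForm d (A * Matrix.single b a 1) ψ
        * qForm d (B * Matrix.single a b 1 - Matrix.single a b 1 * B) ψ
      = Matrix.vecMul (star (ψ : Cvec d).ofLp) B a * (ψ : Cvec d) a
          * (Matrix.vecMul (star (ψ : Cvec d).ofLp) A b * (ψ : Cvec d) b)
        - star ((ψ : Cvec d) a) * (ψ : Cvec d) a
          * (Matrix.vecMul (star (ψ : Cvec d).ofLp) A b * B.mulVec (ψ : Cvec d).ofLp b) :=
    fun a b => by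
      rw [qForm_sub, qForm_mul_single, qForm_mul_single, qForm_single_mul]
      ring
  have hAB : ∑ b, Matrix.vecMul (star (ψ : Cvec d).ofLp) A b * B.mulVec (ψ : Cvec d).ofLp b
      = qForm d (A * B) ψ := by
    rw [qForm_eq_dotProduct, ← Matrix.mulVec_mulVec, Matrix.dotProduct_mulVec]
    rfl
  simp_rw [h, Finset.sum_sub_distrib, ← Finset.mul_sum, ← Finset.sum_mul, sum_vecMul_mul,
    sum_star_mul_self, hAB]
  ring

lemma integral_qForm_mul_mul {d : ℕ} {μ : Measure (USphere d)}
    [IsProbabilityMeasure μ] (hμ : IsUniformOnSphere d μ) (A B C : Matrix (Fin d) (Fin d) ℂ) :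
    ((d : ℂ) + 2) * ∫ ψ : USphere d, qForm d A ψ * qForm d B ψ * qForm d C ψ ∂μ
      = A.trace * ∫ ψ : USphere d, qForm d B ψ * qForm d C ψ ∂μ
        + ∫ ψ : USphere d, qForm d (A * B) ψ * qForm d C ψ ∂μ
        + ∫ ψ : USphere d, qForm d (A * C) ψ * qForm d B ψ ∂μ := by
  have h : ∫ ψ : USphere d, ∑ a : Fin d, ∑ b : Fin d,
      (qForm d (A * Matrix.single b a 1 * Matrix.single a b 1
          - Matrix.single a b 1 * (A * Matrix.single b a 1)) ψ * qForm d B ψ * qForm d C ψ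
        + qForm d (A * Matrix.single b a 1) ψ
          * qForm d (B * Matrix.single a b 1 - Matrix.single a b 1 * B) ψ * qForm d C ψ
        + qForm d (A * Matrix.single b a 1) ψ * qForm d B ψ
          * qForm d (C * Matrix.single a b 1 - Matrix.single a b 1 * C) ψ) ∂μ = 0 := by
    rw [integral_finsetSum _ fun a _ => integrable_of_continuous_sphere (by fun_prop)]
    refine Finset.sum_eq_zero fun a _ => ?_
    rw [integral_finsetSum _ fun b _ => integrable_of_continuous_sphere (by fun_prop)]
    exact Finset.sum_eq_zero fun b _ => integral_qForm_commutator hμ _ B C _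
  have hpt : ∀ ψ : USphere d, ∑ a : Fin d, ∑ b : Fin d,
      (qForm d (A * Matrix.single b a 1 * Matrix.single a b 1
          - Matrix.single a b 1 * (A * Matrix.single b a 1)) ψ * qForm d B ψ * qForm d C ψ
        + qForm d (A * Matrix.single b a 1) ψ
          * qForm d (B * Matrix.single a b 1 - Matrix.single a b 1 * B) ψ * qForm d C ψ
        + qForm d (A * Matrix.single b a 1) ψ * qForm d B ψ
          * qForm d (C * Matrix.single a b 1 - Matrix.single a b 1 * C) ψ)
      = ((d : ℂ) + 2) * (qForm d A ψ * qForm d B ψ * qForm d C ψ)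
        - (A.trace * (qForm d B ψ * qForm d C ψ) + qForm d (A * B) ψ * qForm d C ψ
          + qForm d (A * C) ψ * qForm d B ψ) := fun ψ => by
    simp_rw [mul_right_comm _ (qForm d B ψ) (qForm d (C * _ - _) ψ), Finset.sum_add_distrib,
      ← Finset.sum_mul, sum_qForm_commutator_single, sum_qForm_mul_single_mul_commutator]
    ring
  simp_rw [hpt] at h
  rw [integral_sub, integral_add, integral_add, integral_const_mul, integral_const_mul,
    sub_eq_zero] at h
  · exact h
  all_goals exact integrable_of_continuous_sphere (by fun_prop)

lemma integral_qForm_mul {d : ℕ} {μ : Measure (USphere d)}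
    [IsProbabilityMeasure μ] (hμ : IsUniformOnSphere d μ) (A B : Matrix (Fin d) (Fin d) ℂ) :
    ((d : ℂ) + 1) * ∫ ψ : USphere d, qForm d A ψ * qForm d B ψ ∂μ
      = A.trace * ∫ ψ : USphere d, qForm d B ψ ∂μ + ∫ ψ : USphere d, qForm d (A * B) ψ ∂μ := by
  have h := integral_qForm_mul_mul hμ A B 1
  simp only [qForm_one, mul_one] at h
  linear_combination h

lemma integral_qForm {d : ℕ} {μ : Measure (USphere d)}
    [IsProbabilityMeasure μ] (hμ : IsUniformOnSphere d μ) (A : Matrix (Fin d) (Fin d) ℂ) :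
    (d : ℂ) * ∫ ψ : USphere d, qForm d A ψ ∂μ = A.trace := by
  have h := integral_qForm_mul hμ A 1
  simp only [qForm_one, mul_one, integral_const, probReal_univ, one_smul] at h
  linear_combination h

lemma integral_qForm_mul_eq_trace {d : ℕ} {μ : Measure (USphere d)}
    [IsProbabilityMeasure μ] (hμ : IsUniformOnSphere d μ) (A B : Matrix (Fin d) (Fin d) ℂ) :
    ((d : ℂ) * ((d : ℂ) + 1)) * ∫ ψ : USphere d, qForm d A ψ * qForm d B ψ ∂μ
      = A.trace * B.trace + (A * B).trace := by
  linear_combination (d : ℂ) * integral_qForm_mul hμ A B + A.trace * integral_qForm hμ B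
    + integral_qForm hμ (A * B)

/-- Second and third moments of quadratic forms of a random state:
(i) `d(d+1) ∫ ⟨ψ,Aψ⟩⟨ψ,Bψ⟩ dμ = Tr(A)Tr(B) + Tr(AB)`;
(ii) `d(d+1)(d+2) ∫ ⟨ψ,Aψ⟩⟨ψ,Bψ⟩⟨ψ,Cψ⟩ dμ
  = Tr(A)Tr(B)Tr(C) + Tr(AB)Tr(C) + Tr(AC)Tr(B) + Tr(BC)Tr(A) + Tr(ABC) + Tr(ACB)`. -/
theorem stmt17 (d : ℕ) (hd : 1 ≤ d)
    (μ : Measure (USphere d)) (hμ : IsUniformOnSphere d μ)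
    (A B C : Matrix (Fin d) (Fin d) ℂ)
    (hA : A.IsHermitian) (hB : B.IsHermitian) (hC : C.IsHermitian) :
    ((d : ℂ) * ((d : ℂ) + 1)) *
        (∫ ψ : USphere d, qForm d A (↑ψ) * qForm d B (↑ψ) ∂μ)
      = A.trace * B.trace + (A * B).trace ∧
    ((d : ℂ) * ((d : ℂ) + 1) * ((d : ℂ) + 2)) *
        (∫ ψ : USphere d, qForm d A (↑ψ) * qForm d B (↑ψ) * qForm d C (↑ψ) ∂μ)
      = A.trace * B.trace * C.trace + (A * B).trace * C.trace + (A * C).trace * B.trace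
        + (B * C).trace * A.trace + (A * B * C).trace + (A * C * B).trace := by
  have := hμ.1
  refine ⟨integral_qForm_mul_eq_trace hμ A B, ?_⟩
  linear_combination ((d : ℂ) * ((d : ℂ) + 1)) * integral_qForm_mul_mul hμ A B C
    + A.trace * integral_qForm_mul_eq_trace hμ B C + integral_qForm_mul_eq_trace hμ (A * B) C
    + integral_qForm_mul_eq_trace hμ (A * C) B

end
end
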